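/- arXiv:1212.4349 — 2 statements merged into one kernel-verified Lean document; each statement's English description precedes it below -/
import Mathlib

section
/- Every nilpotent element X ∈ W either lies in the span of {x²D, x³D, …, x^{p−1}D} or is of the form σ(D) for some Lie algebra automorphism σ of W; that is, the nilpotent cone 𝒩 = {X ∈ W : Xᵖ = 0} equals the union of the automorphism-orbit of D and the subspace spanned by {x²D, …, x^{p−1}D}. -/
open Polynomial

/-- The truncated polynomial algebra `A = 𝔽[x]/(xᵖ)`, realized as `𝔽[X] ⧸ (Xᵖ)`. -/
abbrev TruncA (F : Type*) [Field F] (p : ℕ) : Type _ :=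
  AdjoinRoot (X ^ p : F[X])

/-- The image `x` of the indeterminate in `A = 𝔽[x]/(xᵖ)`. -/
noncomputable def xA (F : Type*) [Field F] (p : ℕ) : TruncA F p :=
  AdjoinRoot.root _

/-- The Witt algebra `W₁ = Der_𝔽(A)`, the Lie algebra of `𝔽`-derivations of `A`. -/
abbrev Witt (F : Type*) [Field F] (p : ℕ) : Type _ :=
  Derivation F (TruncA F p) (TruncA F p)

section TruncatedPolynomials

variable {F : Type*} [Field F] {p : ℕ}

theorem truncA_exists_aeval (g : TruncA F p) : ∃ P : F[X], aeval (xA F p) P = g := by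
  obtain ⟨P, rfl⟩ := AdjoinRoot.mk_surjective g
  exact ⟨P, AdjoinRoot.aeval_eq P⟩

theorem aeval_xA_eq_zero_iff (P : F[X]) : aeval (xA F p) P = 0 ↔ X ^ p ∣ P := by
  rw [xA, AdjoinRoot.aeval_eq, AdjoinRoot.mk_eq_zero]

theorem xA_pow_eq_zero : xA F p ^ p = 0 := by
  simpa using (aeval_xA_eq_zero_iff (F := F) (p := p) (X ^ p)).2 dvd_rfl

theorem truncA_exists_algebraMap_add (g : TruncA F p) :
    ∃ (a : F) (r : TruncA F p), g = algebraMap F _ a + xA F p * r := by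
  obtain ⟨P, rfl⟩ := truncA_exists_aeval g
  refine ⟨P.coeff 0, aeval (xA F p) P.divX, ?_⟩
  conv_lhs => rw [← divX_mul_X_add P]
  rw [map_add, map_mul, aeval_X, aeval_C, mul_comm, add_comm]

variable {D : Witt F p}

theorem witt_apply_aeval (hD : D (xA F p) = 1) (P : F[X]) :
    D (aeval (xA F p) P) = aeval (xA F p) (derivative P) := by
  simp [Derivation.map_aeval, hD]

theorem witt_apply_eq_mul (hD : D (xA F p) = 1) (Y : Witt F p) (g : TruncA F p) :
    Y g = Y (xA F p) * D g := by
  obtain ⟨P, rfl⟩ := truncA_exists_aeval g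
  rw [witt_apply_aeval hD, Derivation.map_aeval, smul_eq_mul, mul_comm]

theorem witt_eq_smul (hD : D (xA F p) = 1) (Y : Witt F p) : Y = Y (xA F p) • D := by
  ext g
  exact witt_apply_eq_mul hD Y g

theorem witt_iterate_aeval (hD : D (xA F p) = 1) (P : F[X]) (n : ℕ) :
    (D.toLinearMap ^ n) (aeval (xA F p) P) = aeval (xA F p) (derivative^[n] P) := by
  induction n with
  | zero => simp
  | succ n ih =>
    rw [pow_succ', Module.End.mul_apply, ih, Function.iterate_succ_apply']
    exact witt_apply_aeval hD _

theorem witt_pow_char_eq_zero [Fact p.Prime] [CharP F p] (hD : D (xA F p) = 1) :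
    D.toLinearMap ^ p = 0 := by
  ext g
  obtain ⟨P, rfl⟩ := truncA_exists_aeval g
  have h : derivative^[p] P = 0 := by
    rw [← Polynomial.factorial_smul_hasseDeriv]
    have : ((p.factorial : ℕ) : F) = 0 :=
      (CharP.cast_eq_zero_iff F p _).2 (Nat.dvd_factorial (Fact.out : p.Prime).pos le_rfl)
    ext k
    simp [this]
  rw [witt_iterate_aeval hD, h]
  simp

/-- A polynomial whose derivative vanishes to order `p` at the origin is constant modulo `Xᵖ`. -/
theorem aeval_xA_eq_of_dvd_derivative [Fact p.Prime] [CharP F p] {P : F[X]}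
    (hP : X ^ p ∣ derivative P) : aeval (xA F p) P = algebraMap F _ (P.coeff 0) := by
  rw [← sub_eq_zero, ← aeval_C (xA F p), ← map_sub, aeval_xA_eq_zero_iff, X_pow_dvd_iff]
  intro k hk
  rcases k with _ | k
  · simp
  · have h := X_pow_dvd_iff.1 hP k (by omega)
    rw [coeff_derivative] at h
    have hk' : ((k + 1 : ℕ) : F) ≠ 0 := fun h0 =>
      absurd (Nat.le_of_dvd (by omega) ((CharP.cast_eq_zero_iff F p _).1 h0)) (by omega)
    push_cast at hk'
    simpa [coeff_C, hk'] using h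

theorem exists_algebraMap_of_witt_apply_eq_zero [Fact p.Prime] [CharP F p]
    (hD : D (xA F p) = 1) {Y : Witt F p} {a : F} (ha : a ≠ 0) {r : TruncA F p}
    (hY : Y (xA F p) = algebraMap F _ a + xA F p * r) {g : TruncA F p} (hg : Y g = 0) :
    ∃ c : F, g = algebraMap F _ c := by
  obtain ⟨P, rfl⟩ := truncA_exists_aeval g
  obtain ⟨R, rfl⟩ := truncA_exists_aeval r
  refine ⟨P.coeff 0, aeval_xA_eq_of_dvd_derivative ?_⟩
  have h : aeval (xA F p) ((C a + X * R) * derivative P) = 0 := by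
    rw [witt_apply_eq_mul hD, hY, witt_apply_aeval hD] at hg
    simpa using hg
  rw [aeval_xA_eq_zero_iff] at h
  refine prime_X.pow_dvd_of_dvd_mul_left p ?_ h
  rw [X_dvd_iff]
  simpa using ha

theorem exists_algebraMap_of_apply_eq_zero [Fact p.Prime] [CharP F p]
    (hD : D (xA F p) = 1) {g : TruncA F p} (hg : D g = 0) : ∃ c : F, g = algebraMap F _ c :=
  exists_algebraMap_of_witt_apply_eq_zero hD one_ne_zero (r := 0) (by simpa using hD) hg

end TruncatedPolynomials

section Orbit

variable {F : Type*} [Field F] {p : ℕ} {D : Witt F p}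

theorem witt_toLinearMap_ad_pow (Y E : Witt F p) (n : ℕ) :
    ((LieAlgebra.ad F (Witt F p) Y ^ n) E).toLinearMap =
      ((LinearMap.mulLeft F Y.toLinearMap - LinearMap.mulRight F Y.toLinearMap) ^ n)
        E.toLinearMap := by
  induction n with
  | zero => rfl
  | succ n ih =>
    rw [pow_succ', pow_succ', Module.End.mul_apply, Module.End.mul_apply, ← ih]
    exact Derivation.commutator_coe_linear_map

theorem witt_toLinearMap_ad_pow_char [Fact p.Prime] [CharP F p] (Y E : Witt F p) :
    ((LieAlgebra.ad F (Witt F p) Y ^ p) E).toLinearMap =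
      Y.toLinearMap ^ p * E.toLinearMap - E.toLinearMap * Y.toLinearMap ^ p := by
  have : Nontrivial (TruncA F p) :=
    AdjoinRoot.nontrivial _ (by simpa using (Fact.out : p.Prime).ne_zero)
  have : CharP (Module.End F (Module.End F (TruncA F p))) p :=
    charP_of_injective_algebraMap (algebraMap F _).injective p
  have h := sub_pow_char_of_commute (R := Module.End F (Module.End F (TruncA F p))) p
    (LinearMap.commute_mulLeft_right (R := F) Y.toLinearMap Y.toLinearMap)
  rw [LinearMap.pow_mulLeft, LinearMap.pow_mulRight] at h
  rw [witt_toLinearMap_ad_pow]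
  exact LinearMap.congr_fun h E.toLinearMap

theorem lieEquiv_ad_pow {L : Type*} [LieRing L] [LieAlgebra F L] (σ : L ≃ₗ⁅F⁆ L) (y z : L)
    (n : ℕ) : (LieAlgebra.ad F L (σ y) ^ n) (σ z) = σ ((LieAlgebra.ad F L y ^ n) z) := by
  induction n with
  | zero => rfl
  | succ n ih =>
    rw [pow_succ', pow_succ', Module.End.mul_apply, Module.End.mul_apply, ih]
    exact (LieHom.map_lie (σ : L →ₗ⁅F⁆ L) _ _).symm

/-- A linear endomorphism of `A` killing `1` and commuting with `D` and `xD` is zero. -/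
theorem eq_zero_of_commute [Fact p.Prime] [CharP F p] (hD : D (xA F p) = 1)
    (N : Module.End F (TruncA F p)) (h1 : N 1 = 0) (hN : ∀ E : Witt F p, ∀ g, N (E g) = E (N g)) :
    N = 0 := by
  have key : ∀ k : ℕ, k < p → N (xA F p ^ k) = 0 := by
    intro k
    induction k with
    | zero => intro _; simpa using h1
    | succ k ih =>
      intro hk
      have hDx : D (xA F p ^ (k + 1)) = ((k + 1 : ℕ) : F) • xA F p ^ k := by
        rw [Derivation.leibniz_pow, hD, Nat.add_sub_cancel, smul_eq_mul, mul_one,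
          Nat.cast_smul_eq_nsmul]
      have hc : ((k + 1 : ℕ) : F) ≠ 0 := fun h0 =>
        absurd (Nat.le_of_dvd (by omega) ((CharP.cast_eq_zero_iff F p _).1 h0)) (by omega)
      have h0 : D (N (xA F p ^ (k + 1))) = 0 := by
        rw [← hN, hDx, map_smul, ih (by omega), smul_zero]
      have h2 : (xA F p • D) (xA F p ^ (k + 1)) = ((k + 1 : ℕ) : F) • xA F p ^ (k + 1) := by
        rw [Derivation.smul_apply, hDx, smul_eq_mul, mul_smul_comm, pow_succ']
      have h3 := hN (xA F p • D) (xA F p ^ (k + 1))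
      rw [h2, map_smul, Derivation.smul_apply, h0, smul_zero] at h3
      exact (smul_eq_zero.1 h3).resolve_left hc
  ext g
  obtain ⟨P, rfl⟩ := truncA_exists_aeval g
  rw [aeval_eq_sum_range, map_sum]
  refine Finset.sum_eq_zero fun k _ => ?_
  rw [map_smul]
  by_cases hk : k < p
  · rw [key k hk, smul_zero]
  · rw [pow_eq_zero_of_le (not_lt.1 hk) xA_pow_eq_zero, map_zero, smul_zero]

theorem lieEquiv_apply_pow_char_eq_zero [Fact p.Prime] [CharP F p] (hD : D (xA F p) = 1)
    (σ : Witt F p ≃ₗ⁅F⁆ Witt F p) : (σ D).toLinearMap ^ p = 0 := by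
  have had : ∀ E, (LieAlgebra.ad F (Witt F p) D ^ p) E = 0 := fun E => by
    have h := witt_toLinearMap_ad_pow_char D E
    rw [witt_pow_char_eq_zero hD, zero_mul, mul_zero, sub_zero] at h
    ext g
    exact LinearMap.congr_fun h g
  refine eq_zero_of_commute hD _ ?_ fun E g => ?_
  · rw [← pow_sub_one_mul (Fact.out : p.Prime).ne_zero (σ D).toLinearMap, Module.End.mul_apply]
    simp
  · have h := witt_toLinearMap_ad_pow_char (σ D) E
    have h0 : (LieAlgebra.ad F (Witt F p) (σ D) ^ p) E = 0 := by
      obtain ⟨E, rfl⟩ := σ.surjective E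
      exact (lieEquiv_ad_pow σ D E p).trans (by rw [had, map_zero])
    rw [h0] at h
    have hg := LinearMap.congr_fun h g
    exact sub_eq_zero.1 hg.symm

/-- Conjugation by an algebra automorphism, as an automorphism of the Lie algebra of
derivations. -/
def derivationConj {A : Type*} [CommRing A] [Algebra F A] (e : A ≃ₐ[F] A) :
    Derivation F A A ≃ₗ⁅F⁆ Derivation F A A where
  toFun E := Derivation.mk' (e.toLinearMap ∘ₗ E.toLinearMap ∘ₗ e.symm.toLinearMap)
    fun a b => by simp
  invFun E := Derivation.mk' (e.symm.toLinearMap ∘ₗ E.toLinearMap ∘ₗ e.toLinearMap)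
    fun a b => by simp
  map_add' E E' := Derivation.ext fun a => map_add e (E (e.symm a)) (E' (e.symm a))
  map_smul' c E := Derivation.ext fun a => map_smul e c (E (e.symm a))
  map_lie' {E E'} := Derivation.ext fun a => by
    rw [Derivation.commutator_apply]
    change e (⁅E, E'⁆ (e.symm a)) =
      e (E (e.symm (e (E' (e.symm a))))) - e (E' (e.symm (e (E (e.symm a)))))
    rw [Derivation.commutator_apply, map_sub, e.symm_apply_apply, e.symm_apply_apply]
  left_inv E := Derivation.ext fun a => by
    change e.symm (e (E (e.symm (e a)))) = E a
    rw [e.symm_apply_apply, e.symm_apply_apply]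
  right_inv E := Derivation.ext fun a => by
    change e (e.symm (E (e (e.symm a)))) = E a
    rw [e.apply_symm_apply, e.apply_symm_apply]

theorem derivationConj_apply {A : Type*} [CommRing A] [Algebra F A] (e : A ≃ₐ[F] A)
    (E : Derivation F A A) (a : A) : derivationConj e E a = e (E (e.symm a)) := rfl

theorem exists_lieEquiv_of_apply_eq_one [Fact p.Prime] [CharP F p] (hD : D (xA F p) = 1)
    {Y : Witt F p} {y : TruncA F p} (hy : Y y = 1) :
    ∃ σ : Witt F p ≃ₗ⁅F⁆ Witt F p, σ D = Y := by
  obtain ⟨c, r, hr⟩ := truncA_exists_algebraMap_add y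
  have hz : Y (xA F p * r) = 1 := by rw [← hy, hr, map_add, Derivation.map_algebraMap, zero_add]
  have hzp : aeval (xA F p * r) (X ^ p : F[X]) = 0 := by
    simp [mul_pow, xA_pow_eq_zero]
  let φ : TruncA F p →ₐ[F] TruncA F p := AdjoinRoot.liftAlgHom _ (Algebra.ofId F _) (xA F p * r) hzp
  have hφx : φ (xA F p) = xA F p * r := AdjoinRoot.liftAlgHom_root _ _ _ _
  have hφ : ∀ g, Y (φ g) = φ (D g) := fun g => by
    obtain ⟨P, rfl⟩ := truncA_exists_aeval g
    rw [witt_apply_aeval hD, ← aeval_algHom_apply φ, ← aeval_algHom_apply φ, hφx,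
      Derivation.map_aeval, hz, smul_eq_mul, mul_one]
  have hker : ∀ n : ℕ, ∀ g, (D.toLinearMap ^ n) g = 0 → φ g = 0 → g = 0 := by
    intro n
    induction n with
    | zero => intro g hg _; simpa using hg
    | succ n ih =>
      intro g hg hφg
      rw [pow_succ, Module.End.mul_apply] at hg
      have hDg : D g = 0 := ih _ hg (by rw [← hφ, hφg, map_zero])
      obtain ⟨c, rfl⟩ := exists_algebraMap_of_apply_eq_zero hD hDg
      rwa [AlgHom.commutes] at hφg
  have hinj : Function.Injective φ := (injective_iff_map_eq_zero φ).2 fun g hg =>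
    hker p g (by rw [witt_pow_char_eq_zero hD]; rfl) hg
  have : Module.Finite F (TruncA F p) := (monic_X_pow p).finite_adjoinRoot
  have hsurj : Function.Surjective φ := LinearMap.injective_iff_surjective (f := φ.toLinearMap).1 hinj
  refine ⟨derivationConj (AlgEquiv.ofBijective φ ⟨hinj, hsurj⟩), ?_⟩
  ext g
  obtain ⟨g, rfl⟩ := (AlgEquiv.ofBijective φ ⟨hinj, hsurj⟩).surjective g
  rw [derivationConj_apply, AlgEquiv.symm_apply_apply]
  exact (hφ g).symm

theorem exists_apply_eq_one [Fact p.Prime] [CharP F p] (hD : D (xA F p) = 1) {Y : Witt F p}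
    (hnil : Y.toLinearMap ^ p = 0) {a : F} (ha : a ≠ 0) {r : TruncA F p}
    (hY : Y (xA F p) = algebraMap F _ a + xA F p * r) : ∃ y, Y y = 1 := by
  by_contra! hne
  have hker : ∀ g, Y (Y g) = 0 → Y g = 0 := fun g hg => by
    obtain ⟨c, hc⟩ := exists_algebraMap_of_witt_apply_eq_zero hD ha hY hg
    by_cases h0 : c = 0
    · rw [hc, h0, map_zero]
    · refine absurd ?_ (hne (c⁻¹ • g))
      rw [Derivation.map_smul, hc, Algebra.smul_def, ← map_mul, inv_mul_cancel₀ h0, map_one]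
  have hiter : ∀ n : ℕ, ∀ g, (Y.toLinearMap ^ n) g = 0 → Y g = 0 := by
    intro n
    induction n with
    | zero => intro g hg; simp only [pow_zero, Module.End.one_apply] at hg; rw [hg, map_zero]
    | succ n ih =>
      intro g hg
      rw [pow_succ, Module.End.mul_apply] at hg
      exact hker g (ih _ hg)
  obtain ⟨R, rfl⟩ := truncA_exists_aeval r
  have h0 : Y (xA F p) = 0 := hiter p _ (by rw [hnil]; rfl)
  have h : aeval (xA F p) (C a + X * R) = 0 := by
    rw [← h0, hY]
    simp
  rw [aeval_xA_eq_zero_iff, X_pow_dvd_iff] at h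
  exact ha (by simpa using h 0 (Fact.out : p.Prime).pos)

end Orbit

section Filtration

variable {F : Type*} [Field F] {p : ℕ} {D : Witt F p}

theorem exists_apply_eq_sq_mul_of_pow_eq_zero (hp : 2 ≤ p) (hD : D (xA F p) = 1) {Y : Witt F p}
    (hnil : Y.toLinearMap ^ p = 0) {h : TruncA F p} (hY : Y (xA F p) = xA F p * h) :
    ∃ r, Y (xA F p) = xA F p ^ 2 * r := by
  have hiter : ∀ n : ℕ, ∃ r, (Y.toLinearMap ^ n) (xA F p) = xA F p * h ^ n + xA F p ^ 2 * r := by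
    intro n
    induction n with
    | zero => exact ⟨0, by simp⟩
    | succ n ih =>
      obtain ⟨r, hr⟩ := ih
      refine ⟨h * D (h ^ n) + h * (2 * r + xA F p * D r), ?_⟩
      rw [pow_succ', Module.End.mul_apply, hr]
      change Y _ = _
      rw [witt_apply_eq_mul hD, hY, map_add, Derivation.leibniz, Derivation.leibniz,
        Derivation.leibniz_pow D (xA F p), hD]
      simp only [smul_eq_mul, nsmul_eq_mul]
      push_cast
      ring
  obtain ⟨r, hr⟩ := hiter p
  rw [hnil] at hr
  obtain ⟨H, rfl⟩ := truncA_exists_aeval h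
  obtain ⟨R, rfl⟩ := truncA_exists_aeval r
  have h0 : aeval (xA F p) (X * H ^ p + X ^ 2 * R) = 0 := by
    simpa using hr.symm
  rw [aeval_xA_eq_zero_iff] at h0
  have h2 : X * X ∣ X * (H ^ p + X * R) := by
    rw [← sq]
    convert (pow_dvd_pow X hp).trans h0 using 1
    ring
  have h3 : X ∣ H ^ p := (dvd_add_left (dvd_mul_right _ _)).1 ((mul_dvd_mul_iff_left X_ne_zero).1 h2)
  obtain ⟨Q, rfl⟩ := prime_X.dvd_of_dvd_pow h3
  refine ⟨aeval (xA F p) Q, ?_⟩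
  rw [hY, map_mul, aeval_X]
  ring

theorem sq_mul_smul_mem_span (r : TruncA F p) :
    (xA F p ^ 2 * r) • D ∈
      Submodule.span F ((fun i : ℕ => xA F p ^ i • D) '' Set.Icc 2 (p - 1)) := by
  obtain ⟨R, rfl⟩ := truncA_exists_aeval r
  rw [aeval_eq_sum_range, Finset.mul_sum, Finset.sum_smul]
  refine Submodule.sum_mem _ fun k _ => ?_
  rw [mul_smul_comm, ← pow_add, smul_assoc]
  refine Submodule.smul_mem _ _ ?_
  by_cases hk : 2 + k < p
  · exact Submodule.subset_span ⟨2 + k, ⟨by omega, by omega⟩, rfl⟩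
  · rw [pow_eq_zero_of_le (not_lt.1 hk) xA_pow_eq_zero, zero_smul]
    exact Submodule.zero_mem _

theorem exists_apply_eq_sq_mul_of_mem_span (hD : D (xA F p) = 1) {Y : Witt F p}
    (hY : Y ∈ Submodule.span F ((fun i : ℕ => xA F p ^ i • D) '' Set.Icc 2 (p - 1))) :
    ∃ r, Y (xA F p) = xA F p ^ 2 * r := by
  induction hY using Submodule.span_induction with
  | mem Y hY =>
    obtain ⟨i, hi, rfl⟩ := hY
    refine ⟨xA F p ^ (i - 2), ?_⟩
    rw [← pow_add, Nat.add_sub_cancel' hi.1]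
    simp [hD]
  | zero => exact ⟨0, by simp⟩
  | add Y Z _ _ hY hZ =>
    obtain ⟨r, hr⟩ := hY
    obtain ⟨s, hs⟩ := hZ
    exact ⟨r + s, by rw [Derivation.add_apply, hr, hs, mul_add]⟩
  | smul c Y _ hY =>
    obtain ⟨r, hr⟩ := hY
    exact ⟨c • r, by rw [Derivation.smul_apply, hr, mul_smul_comm]⟩

theorem pow_eq_zero_of_apply_eq_sq_mul (hD : D (xA F p) = 1) {Y : Witt F p} {r : TruncA F p}
    (hY : Y (xA F p) = xA F p ^ 2 * r) : Y.toLinearMap ^ p = 0 := by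
  have hiter : ∀ (n : ℕ) (g : TruncA F p), ∃ s, (Y.toLinearMap ^ n) g = xA F p ^ n * s := by
    intro n g
    induction n with
    | zero => exact ⟨g, by simp⟩
    | succ n ih =>
      obtain ⟨s, hs⟩ := ih
      refine ⟨n * s * r + xA F p * r * D s, ?_⟩
      rw [pow_succ', Module.End.mul_apply, hs]
      change Y _ = _
      rw [witt_apply_eq_mul hD, hY, Derivation.leibniz, Derivation.leibniz_pow, hD]
      rcases n with _ | n
      · simp; ring
      · simp only [smul_eq_mul, nsmul_eq_mul, Nat.add_sub_cancel]
        ring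
  ext g
  obtain ⟨s, hs⟩ := hiter p g
  rw [hs, xA_pow_eq_zero, zero_mul]
  rfl

end Filtration

/-- The nilpotent cone `𝒩 = {X ∈ W : Xᵖ = 0}` is the union of the automorphism-orbit of `D`
and the subspace spanned by `{x²D, …, x^{p−1}D}`. -/
theorem nilpotent_cone_eq_orbit_union_g1
    (F : Type*) [Field F] [IsAlgClosed F] (p : ℕ) [Fact p.Prime] [CharP F p] (hp : 3 < p)
    (D : Witt F p) (hD : D (xA F p) = 1) :
    {Y : Witt F p | Y.toLinearMap ^ p = 0} =
      {Y : Witt F p | ∃ σ : Witt F p ≃ₗ⁅F⁆ Witt F p, σ D = Y} ∪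
        (Submodule.span F ((fun i : ℕ => xA F p ^ i • D) '' Set.Icc 2 (p - 1)) :
          Set (Witt F p)) := by
  have hprime : p.Prime := Fact.out
  ext Y
  simp only [Set.mem_ofPred_eq, Set.mem_union, SetLike.mem_coe]
  constructor
  · intro hnil
    obtain ⟨a, r, hY⟩ := truncA_exists_algebraMap_add (Y (xA F p))
    by_cases ha : a = 0
    · rw [ha, map_zero, zero_add] at hY
      obtain ⟨s, hs⟩ := exists_apply_eq_sq_mul_of_pow_eq_zero hprime.two_le hD hnil hY
      right
      rw [witt_eq_smul hD Y, hs]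
      exact sq_mul_smul_mem_span s
    · obtain ⟨y, hy⟩ := exists_apply_eq_one hD hnil ha hY
      exact Or.inl (exists_lieEquiv_of_apply_eq_one hD hy)
  · rintro (⟨σ, rfl⟩ | hY)
    · exact lieEquiv_apply_pow_char_eq_zero hD σ
    · obtain ⟨r, hr⟩ := exists_apply_eq_sq_mul_of_mem_span hD hY
      exact pow_eq_zero_of_apply_eq_sq_mul hD hr
end

section
/- Let k₋₁, k₀, …, k_{p−2} ∈ 𝔽 and X = Σ_{i=−1}^{p−2} kᵢ·x^{i+1}D ∈ W. Then Xᵖ = −f·X as linear endomorphisms of A, where f = det M and M is the (p−1)×(p−1) matrix with rows and columns indexed by 0, …, p−2 whose (i,j) entry is (j+1)·k_{i−j} (with the convention k_m = 0 for m < −1). In particular, Xᵖ = 0 if and only if f = 0. -/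
open Polynomial

namespace TruncA

variable {F : Type*} [Field F] {p : ℕ}

/-- The coefficient of `xⁿ` of an element of `𝔽[x]/(xᵖ)`. -/
noncomputable def coeff (F : Type*) [Field F] (p n : ℕ) : TruncA F p →ₗ[F] F :=
  Polynomial.lcoeff F n ∘ₗ AdjoinRoot.modByMonicHom (monic_X_pow p)

/-- The augmentation `𝔽[x]/(xᵖ) → 𝔽`, `x ↦ 0`. -/
noncomputable def augmentation (F : Type*) [Field F] {p : ℕ} (hp : p ≠ 0) : TruncA F p →ₐ[F] F :=
  AdjoinRoot.liftAlgHom (X ^ p : F[X]) (AlgHom.id F F) 0 (by simp [hp])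

@[simp]
theorem augmentation_xA (hp : p ≠ 0) : augmentation F hp (xA F p) = 0 := by
  simp [augmentation, xA]

theorem xA_pow_self : xA F p ^ p = 0 := by
  have h := AdjoinRoot.mk_self (f := (X ^ p : F[X]))
  rwa [map_pow, AdjoinRoot.mk_X] at h

theorem coeff_xA_pow {m : ℕ} (n : ℕ) (hm : m < p) :
    coeff F p n (xA F p ^ m) = if n = m then 1 else 0 := by
  have h : xA F p ^ m = AdjoinRoot.mk (X ^ p : F[X]) (X ^ m) := by
    rw [map_pow, AdjoinRoot.mk_X, xA]
  rw [h, coeff, LinearMap.comp_apply, AdjoinRoot.modByMonicHom_mk,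
    (modByMonic_eq_self_iff (monic_X_pow p)).2 (by simpa using hm), lcoeff_apply, coeff_X_pow]

theorem coeff_xA_pow_of_lt {n : ℕ} (m : ℕ) (hn : n < p) :
    coeff F p n (xA F p ^ m) = if n = m then 1 else 0 := by
  rcases lt_or_ge m p with hm | hm
  · exact coeff_xA_pow n hm
  · rw [pow_eq_zero_of_le hm xA_pow_self, map_zero, if_neg (by omega)]

theorem sum_coeff_smul (h : TruncA F p) :
    ∑ n ∈ Finset.range p, coeff F p n h • xA F p ^ n = h := by
  obtain ⟨f, rfl⟩ := AdjoinRoot.mk_surjective h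
  conv_rhs => rw [← AdjoinRoot.mk_leftInverse (monic_X_pow p) (AdjoinRoot.mk _ f)]
  have hd : (AdjoinRoot.modByMonicHom (monic_X_pow p) (AdjoinRoot.mk _ f)).degree < (p : ℕ) := by
    rw [AdjoinRoot.modByMonicHom_mk]
    simpa using degree_modByMonic_lt f (monic_X_pow (R := F) p)
  have hsum (g : F[X]) (hg : g.degree < (p : ℕ)) :
      g = ∑ n ∈ Finset.range p, monomial n (g.coeff n) := by
    ext n
    simp only [finsetSum_coeff, coeff_monomial, Finset.sum_ite_eq', Finset.mem_range]
    split_ifs with hn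
    · rfl
    · exact coeff_eq_zero_of_degree_lt (hg.trans_le (by exact_mod_cast not_lt.1 hn))
  conv_rhs => rw [hsum _ hd]
  rw [map_sum]
  refine Finset.sum_congr rfl fun n _ => ?_
  rw [← C_mul_X_pow_eq_monomial, map_mul, map_pow, AdjoinRoot.mk_X, AdjoinRoot.mk_C,
    Algebra.smul_def]
  rfl

theorem linearMap_ext {V : Type*} [AddCommMonoid V] [Module F V] {f g : TruncA F p →ₗ[F] V}
    (hfg : ∀ n < p, f (xA F p ^ n) = g (xA F p ^ n)) : f = g := by
  ext h
  rw [← sum_coeff_smul h, map_sum, map_sum]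
  refine Finset.sum_congr rfl fun n hn => ?_
  rw [map_smul, map_smul, hfg n (Finset.mem_range.1 hn)]

theorem derivation_ext {D₁ D₂ : Witt F p} (h : D₁ (xA F p) = D₂ (xA F p)) : D₁ = D₂ := by
  have : D₁.toLinearMap = D₂.toLinearMap := linearMap_ext fun n _ => by
    change D₁ _ = D₂ _
    rw [Derivation.leibniz_pow, Derivation.leibniz_pow, h]
  ext a
  exact LinearMap.congr_fun this a

theorem coeff_derivation {D : Witt F p} (hD : D (xA F p) = 1) {n : ℕ} (hn : n + 1 < p)
    (h : TruncA F p) : coeff F p n (D h) = (n + 1) * coeff F p (n + 1) h := by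
  have : coeff F p n ∘ₗ D.toLinearMap = ((n : F) + 1) • coeff F p (n + 1) :=
    linearMap_ext fun m hm => by
      change coeff F p n (D (xA F p ^ m)) = ((n : F) + 1) • coeff F p (n + 1) (xA F p ^ m)
      rw [Derivation.leibniz_pow, hD, coeff_xA_pow _ hm, map_nsmul, smul_eq_mul, mul_one,
        coeff_xA_pow_of_lt _ (by omega)]
      rcases m with _ | m
      · simp
      · by_cases hnm : n = m <;> simp [hnm]
  exact LinearMap.congr_fun this h

theorem eq_algebraMap_of_coeff_eq_zero (hp : p ≠ 0) (h : TruncA F p)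
    (hc : ∀ n, n + 1 < p → coeff F p (n + 1) h = 0) :
    h = algebraMap F (TruncA F p) (coeff F p 0 h) := by
  obtain ⟨q, rfl⟩ := Nat.exists_eq_succ_of_ne_zero hp
  conv_lhs => rw [← sum_coeff_smul h, Finset.sum_range_succ']
  rw [Finset.sum_eq_zero fun n hn => by
    rw [hc n (by simpa using hn), zero_smul], zero_add, pow_zero, Algebra.algebraMap_eq_smul_one]

theorem eq_algebraMap_of_derivation_eq_zero [Fact p.Prime] [CharP F p] {D : Witt F p}
    (hD : D (xA F p) = 1) (h : TruncA F p) (hh : D h = 0) :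
    h = algebraMap F (TruncA F p) (coeff F p 0 h) := by
  refine eq_algebraMap_of_coeff_eq_zero (Fact.out : p.Prime).ne_zero h fun n hn => ?_
  have := coeff_derivation hD hn h
  rw [hh, map_zero] at this
  refine (mul_eq_zero.1 this.symm).resolve_left fun h0 => ?_
  have h1 : ((n + 1 : ℕ) : F) = 0 := by exact_mod_cast h0
  rw [CharP.cast_eq_zero_iff F p] at h1
  exact absurd (Nat.le_of_dvd n.succ_pos h1) (by omega)

theorem isUnit_of_augmentation_ne_zero (hp : p ≠ 0) {u : TruncA F p}
    (hu : augmentation F hp u ≠ 0) : IsUnit u := by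
  obtain ⟨q, rfl⟩ := Nat.exists_eq_succ_of_ne_zero hp
  have h := sum_coeff_smul u
  rw [Finset.sum_range_succ', pow_zero] at h
  simp_rw [pow_succ, ← smul_mul_assoc, ← Finset.sum_mul] at h
  set w := ∑ i ∈ Finset.range q, coeff F (q + 1) (i + 1) u • xA F (q + 1) ^ i
  rw [← h, map_add, map_mul, augmentation_xA, mul_zero, zero_add, map_smul, map_one,
    smul_eq_mul, mul_one] at hu
  rw [← h]
  refine IsNilpotent.isUnit_add_right_of_commute ⟨q + 1, ?_⟩ ?_ (Commute.all _ _)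
  · rw [mul_pow, xA_pow_self, mul_zero]
  · rw [← Algebra.algebraMap_eq_smul_one]
    exact (IsUnit.mk0 _ hu).map _

end TruncA

/-- In characteristic `p`, the `p`-th power of a derivation satisfies the Leibniz rule. -/
theorem Derivation.pow_char_leibniz {F A : Type*} [Field F] [CommRing A] [Algebra F A]
    (p : ℕ) [Fact p.Prime] [CharP F p] [Nontrivial A] (Y : Derivation F A A) (a b : A) :
    (Y.toLinearMap ^ p) (a * b) = a * (Y.toLinearMap ^ p) b + b * (Y.toLinearMap ^ p) a := by
  set T : Module.End F A := Y.toLinearMap with hT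
  set δ : Module.End F (Module.End F A) := LinearMap.mulLeft F T - LinearMap.mulRight F T with hδ
  have hpow : ∀ n : ℕ, (δ ^ n) (LinearMap.mulLeft F a) = LinearMap.mulLeft F ((T ^ n) a) := by
    intro n
    induction n with
    | zero => simp
    | succ n ih =>
      rw [pow_succ', Module.End.mul_apply, ih, pow_succ', Module.End.mul_apply]
      ext c
      simp [hδ, hT, mul_comm]
  have : CharP (Module.End F (Module.End F A)) p :=
    charP_of_injective_algebraMap (algebraMap F _).injective p
  have hδp : δ ^ p = LinearMap.mulLeft F T ^ p - LinearMap.mulRight F T ^ p :=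
    sub_pow_char_of_commute (R := Module.End F (Module.End F A)) p (LinearMap.commute_mulLeft_right T T)
  have h := hpow p
  rw [hδp, LinearMap.pow_mulLeft, LinearMap.pow_mulRight] at h
  have hb := LinearMap.congr_fun h b
  simp only [LinearMap.sub_apply, LinearMap.mulLeft_apply, LinearMap.mulRight_apply,
    Module.End.mul_apply] at hb
  rw [sub_eq_iff_eq_add.1 hb]
  ring

namespace TruncA

variable {F : Type*} [Field F] {p : ℕ}

theorem derivation_pow_char_eq_smul [Fact p.Prime] [CharP F p] {D : Witt F p}
    (hD : D (xA F p) = 1) {u : TruncA F p} (hu : IsUnit u) :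
    ∃ c : F, (u • D).toLinearMap ^ p = c • (u • D).toLinearMap := by
  obtain ⟨v, hv⟩ := hu.exists_right_inv
  have : Nontrivial (TruncA F p) :=
    AdjoinRoot.nontrivial _ (by simpa using (Fact.out : p.Prime).ne_zero)
  set Y : Witt F p := u • D with hY
  have hYa (a : TruncA F p) : Y a = u * D a := rfl
  let Z : Witt F p := Derivation.mk' (Y.toLinearMap ^ p) (Derivation.pow_char_leibniz p Y)
  have hYx : Y (xA F p) = u := by rw [hYa, hD, mul_one]
  set h := Z (xA F p) * v with hh
  have hZ : Z = h • Y := derivation_ext (by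
    rw [Derivation.smul_apply, hYx, smul_eq_mul, hh]; linear_combination -Z (xA F p) * hv)
  have hcomm (a : TruncA F p) : Z (Y a) = Y (Z a) := by
    change (Y.toLinearMap ^ p * Y.toLinearMap) a = (Y.toLinearMap * Y.toLinearMap ^ p) a
    rw [← pow_succ, ← pow_succ']
  have hx := hcomm (xA F p)
  simp only [hZ, Derivation.smul_apply, smul_eq_mul, Derivation.leibniz, hYx] at hx
  have hDh : D h = 0 := by
    rw [hYa h] at hx
    linear_combination (-v ^ 2) * hx - D h * (u * v + 1) * hv
  have hc := eq_algebraMap_of_derivation_eq_zero hD h hDh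
  refine ⟨coeff F p 0 h, ?_⟩
  ext a
  change Z a = coeff F p 0 h • Y a
  rw [hZ, Derivation.smul_apply, Algebra.smul_def (coeff F p 0 h), ← hc, smul_eq_mul]

theorem exists_pow_apply_xA_pow [Fact p.Prime] [CharP F p] (hp : p ≠ 0) {Y : Witt F p}
    (hY : augmentation F hp (Y (xA F p)) ≠ 0) (i m : ℕ) (him : m + i < p) :
    ∃ v, (Y.toLinearMap ^ i) (xA F p ^ (m + i)) = xA F p ^ m * v ∧ augmentation F hp v ≠ 0 := by
  induction i generalizing m with
  | zero => exact ⟨1, by simp⟩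
  | succ i ih =>
    obtain ⟨v, hv, hv0⟩ := ih (m + 1) (by omega)
    refine ⟨((m + 1 : ℕ) : F) • (Y (xA F p) * v) + xA F p * Y v, ?_, ?_⟩
    · rw [pow_succ', Module.End.mul_apply, show m + (i + 1) = m + 1 + i by ring, hv]
      change Y _ = _
      rw [Derivation.leibniz, Derivation.leibniz_pow]
      simp only [smul_eq_mul, nsmul_eq_mul, Nat.cast_smul_eq_nsmul, Nat.add_sub_cancel]
      ring
    · simp only [map_add, map_smul, map_mul, augmentation_xA, zero_mul, add_zero, smul_eq_mul]
      refine mul_ne_zero (fun h => ?_) (mul_ne_zero hY hv0)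
      rw [CharP.cast_eq_zero_iff F p] at h
      exact absurd (Nat.le_of_dvd m.succ_pos h) (by omega)

theorem eq_zero_of_aeval_eq_zero [Fact p.Prime] [CharP F p] (hp : p ≠ 0) {Y : Witt F p}
    (hY : augmentation F hp (Y (xA F p)) ≠ 0) {q : F[X]} (hq : q.degree < p)
    (h : aeval (Y.toLinearMap : Module.End F (TruncA F p)) q = 0) : q = 0 := by
  by_contra hq0
  have hd : q.natDegree < p := (natDegree_lt_iff_degree_lt hq0).2 hq
  have hx := congrArg (augmentation F hp) (LinearMap.congr_fun h (xA F p ^ q.natDegree))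
  rw [aeval_eq_sum_range, LinearMap.sum_apply, map_sum, Finset.sum_range_succ,
    Finset.sum_eq_zero, zero_add, LinearMap.smul_apply, map_smul, LinearMap.zero_apply,
    map_zero, smul_eq_mul] at hx
  · obtain ⟨v, hv, hv0⟩ := exists_pow_apply_xA_pow hp hY q.natDegree 0 (by omega)
    rw [zero_add] at hv
    rw [hv, pow_zero, one_mul] at hx
    exact mul_ne_zero (leadingCoeff_ne_zero.2 hq0) hv0 hx
  · intro i hi
    have hi' := Finset.mem_range.1 hi
    obtain ⟨v, hv, -⟩ := exists_pow_apply_xA_pow hp hY i (q.natDegree - i) (by omega)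
    rw [Nat.sub_add_cancel hi'.le] at hv
    rw [LinearMap.smul_apply, map_smul, hv, map_mul, map_pow, augmentation_xA,
      zero_pow (by omega), zero_mul, smul_zero]

end TruncA

theorem Polynomial.degree_sub_X_pow_sub_lt {F : Type*} [Field F] {p : ℕ} {q : F[X]}
    (hq : q.Monic) (hdeg : q.degree = p) (hp : 1 < p) (c : F) :
    (q - (X ^ p - C c * X)).degree < (p : WithBot ℕ) := by
  rw [← sub_add]
  refine (degree_add_le _ _).trans_lt
    (max_lt ?_ ((degree_C_mul_X_le _).trans_lt (by exact_mod_cast hp)))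
  rw [← hdeg]
  exact degree_sub_lt_left (by rw [hdeg, degree_X_pow]) hq.ne_zero (by
    rw [hq.leadingCoeff, leadingCoeff_X_pow])

/-- The homogeneous form of `∏ a ∈ 𝔽ₚ, (X - a) = Xᵖ - X`. -/
theorem Polynomial.prod_range_X_sub_natCast_mul {F : Type*} [Field F] (p : ℕ) [Fact p.Prime]
    [CharP F p] (c : F) :
    ∏ j ∈ Finset.range p, (X - C ((j : F) * c)) = X ^ p - C (c ^ (p - 1)) * X := by
  have hp : p.Prime := Fact.out
  by_cases hc : c = 0
  · simp [hc, zero_pow (Nat.sub_ne_zero_of_lt hp.one_lt)]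
  have hinj : Set.InjOn (fun j : ℕ => (j : F) * c) (Finset.range p) := by
    intro i hi j hj hij
    have h := mul_right_cancel₀ hc hij
    exact CharP.natCast_injOn_Iio F p (by simpa using hi) (by simpa using hj) h
  refine eq_of_degree_sub_lt_of_eval_index_eq (Finset.range p) hinj ?_ fun j hj => ?_
  · rw [Finset.card_range]
    exact degree_sub_X_pow_sub_lt (monic_prod_of_monic _ _ fun j _ => monic_X_sub_C _)
      (by simp only [degree_prod, degree_X_sub_C]; simp) hp.one_lt _
  · rw [eval_prod, Finset.prod_eq_zero hj (by simp)]
    have hf : (j : F) ^ p = j := by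
      have := congrArg (ZMod.castHom (dvd_refl p) F) (ZMod.pow_card (j : ZMod p))
      rwa [map_pow, map_natCast] at this
    simp only [eval_sub, eval_pow, eval_X, eval_mul, eval_C]
    rw [mul_pow, hf, ← mul_assoc, mul_comm (c ^ (p - 1)), mul_assoc, ← pow_succ,
      Nat.sub_add_cancel hp.one_le, sub_self]

/-- If `π` intertwines `T` with the action of a matrix `M`, it intertwines `q(T)` with `q(M)`. -/
theorem Matrix.apply_aeval_eq_mulVec {F V n : Type*} [Field F] [AddCommGroup V] [Module F V]
    [Fintype n] [DecidableEq n] {T : Module.End F V} {M : Matrix n n F} {π : V →ₗ[F] (n → F)}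
    (h : ∀ v, π (T v) = M.mulVec (π v)) (q : F[X]) (v : V) :
    π (aeval T q v) = (aeval M q).mulVec (π v) := by
  induction q using Polynomial.induction_on' generalizing v with
  | add q r hq hr => simp [hq, hr, Matrix.add_mulVec]
  | monomial m a =>
    have hpow (m : ℕ) (v : V) : π ((T ^ m) v) = (M ^ m).mulVec (π v) := by
      induction m generalizing v with
      | zero => simp
      | succ m ih => rw [pow_succ, Module.End.mul_apply, ih, h, Matrix.mulVec_mulVec, pow_succ]
    simp [aeval_monomial, ← Algebra.smul_def, hpow, Matrix.smul_mulVec]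

namespace TruncA

variable {F : Type*} [Field F] {p : ℕ}

theorem X_mul_charpoly_eq_of_superdiagonal_eq_zero [Fact p.Prime] [CharP F p]
    (k : ℤ → F) (hk : ∀ m : ℤ, m ≤ -1 → k m = 0)
    (M : Matrix (Fin (p - 1)) (Fin (p - 1)) F)
    (hM : ∀ i j : Fin (p - 1), M i j = ((j : ℕ) + 1 : F) * k (((i : ℕ) : ℤ) - ((j : ℕ) : ℤ))) :
    X * M.charpoly = X ^ p - C (k 0 ^ (p - 1)) * X := by
  have hp : p.Prime := Fact.out
  rw [← prod_range_X_sub_natCast_mul, ← Matrix.charpoly_transpose,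
    Matrix.charpoly_of_isUpperTriangular]
  · obtain ⟨q, rfl⟩ := Nat.exists_eq_succ_of_ne_zero hp.ne_zero
    rw [Finset.prod_range_succ', mul_comm]
    simpa [hM] using
      Fin.prod_univ_eq_prod_range (fun j => (X - C (((j : F) + 1) * k 0) : F[X])) q
  · intro i j hij
    have : (j : ℕ) < i := hij
    rw [Matrix.transpose_apply, hM, hk _ (by omega), mul_zero]

theorem coeff_derivation_eq_mulVec {D : Witt F p} (hD : D (xA F p) = 1)
    (k : ℤ → F) (hk : ∀ m : ℤ, m < -1 → k m = 0)
    (M : Matrix (Fin (p - 1)) (Fin (p - 1)) F)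
    (hM : ∀ i j : Fin (p - 1), M i j = ((j : ℕ) + 1 : F) * k (((i : ℕ) : ℤ) - ((j : ℕ) : ℤ)))
    {u : TruncA F p} (hu : u = ∑ n ∈ Finset.range p, k ((n : ℤ) - 1) • xA F p ^ n)
    (h : TruncA F p) :
    LinearMap.pi (fun i : Fin (p - 1) => coeff F p (i + 1)) ((u • D) h) =
      M.mulVec (LinearMap.pi (fun i : Fin (p - 1) => coeff F p (i + 1)) h) := by
  suffices H : LinearMap.pi (fun i : Fin (p - 1) => coeff F p (i + 1)) ∘ₗ (u • D).toLinearMap =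
      M.mulVecLin ∘ₗ LinearMap.pi (fun i : Fin (p - 1) => coeff F p (i + 1)) from
    LinearMap.congr_fun H h
  refine linearMap_ext fun m hm => funext fun i => ?_
  have hi := i.2
  change coeff F p (i + 1) (u * D (xA F p ^ m)) =
    ∑ j, M i j * coeff F p (j + 1) (xA F p ^ m)
  rw [Derivation.leibniz_pow, hD, smul_eq_mul, mul_one, hu, mul_smul_comm, map_nsmul,
    Finset.sum_mul, map_sum]
  simp_rw [smul_mul_assoc, ← pow_add, map_smul,
    coeff_xA_pow_of_lt _ (show (i : ℕ) + 1 < p by omega), coeff_xA_pow _ hm]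
  rcases m with _ | m
  · simp
  · rw [Finset.sum_eq_single (⟨m, by omega⟩ : Fin (p - 1))
      (fun j _ hj => by
        rw [if_neg (fun h => hj (Fin.ext (by simpa using h))), mul_zero]) (by simp)]
    rw [if_pos rfl, mul_one, hM, nsmul_eq_mul]
    push_cast
    congr 1
    simp only [smul_eq_mul, mul_ite, mul_one, mul_zero]
    by_cases hmi : m ≤ i + 1
    · rw [Finset.sum_eq_single ((i : ℕ) + 1 - m) (fun n _ hn => if_neg (by omega))
        (fun hn => absurd (Finset.mem_range.2 (by omega)) hn), if_pos (by omega)]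
      congr 1
      omega
    · rw [Finset.sum_eq_zero fun n _ => if_neg (by omega), hk _ (by omega)]

end TruncA

open TruncA in
/-- For `X = ∑_{i=−1}^{p−2} kᵢ x^{i+1}D`, one has `Xᵖ = −f·X` as linear endomorphisms of `A`,
where `f = det M` and `M` is the `(p−1)×(p−1)` matrix with `(i,j)`-entry `(j+1)·k_{i−j}`
(with `k_m = 0` for `m < −1`). In particular `Xᵖ = 0` if and only if `f = 0`. -/
theorem pth_power_eq_neg_det_smul
    (F : Type*) [Field F] [IsAlgClosed F] (p : ℕ) [Fact p.Prime] [CharP F p] (hp : 3 < p)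
    (D : Witt F p) (hD : D (xA F p) = 1)
    (k : ℤ → F) (hk : ∀ m : ℤ, m < -1 → k m = 0)
    (Y : Witt F p)
    (hY : Y = ∑ i ∈ Finset.Icc (-1 : ℤ) ((p : ℤ) - 2), k i • (xA F p ^ (i + 1).toNat • D))
    (M : Matrix (Fin (p - 1)) (Fin (p - 1)) F)
    (hM : ∀ i j : Fin (p - 1), M i j = ((j : ℕ) + 1 : F) * k (((i : ℕ) : ℤ) - ((j : ℕ) : ℤ))) :
    Y.toLinearMap ^ p = -M.det • Y.toLinearMap ∧
      (Y.toLinearMap ^ p = 0 ↔ M.det = 0) := by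
  have hp0 : p ≠ 0 := by omega
  obtain ⟨u, hu⟩ : ∃ u, u = ∑ n ∈ Finset.range p, k ((n : ℤ) - 1) • xA F p ^ n := ⟨_, rfl⟩
  have hYu : Y = u • D := by
    rw [hY, hu, Finset.sum_smul]
    refine Finset.sum_nbij' (fun i => (i + 1).toNat) (fun n => (n : ℤ) - 1) ?_ ?_ ?_ ?_ ?_
    · intro i hi
      simp only [Finset.mem_Icc, Finset.mem_range] at *
      omega
    · intro n hn
      simp only [Finset.mem_Icc, Finset.mem_range] at *
      omega
    · intro i hi
      simp only [Finset.mem_Icc] at *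
      omega
    · intro n hn
      simp
    · intro i hi
      have : (((i + 1).toNat : ℕ) : ℤ) - 1 = i := by
        simp only [Finset.mem_Icc] at hi
        omega
      rw [this, smul_assoc]
  have hπ := coeff_derivation_eq_mulVec hD k hk M hM hu
  rw [← hYu] at hπ
  have hconst (h : TruncA F p) :
      LinearMap.pi (fun i : Fin (p - 1) => coeff F p (i + 1)) h = 0 → Y h = 0 := fun h0 => by
    rw [eq_algebraMap_of_coeff_eq_zero hp0 h fun n hn =>
      congrFun h0 (⟨n, by omega⟩ : Fin (p - 1)), Derivation.map_algebraMap]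
  have hann : aeval (Y.toLinearMap : Module.End F (TruncA F p)) (X * M.charpoly) = 0 := by
    ext h
    rw [map_mul, aeval_X, Module.End.mul_apply]
    refine hconst _ ?_
    rw [Matrix.apply_aeval_eq_mulVec (T := Y.toLinearMap) hπ, Matrix.aeval_self_charpoly,
      Matrix.zero_mulVec]
  obtain ⟨c, hc⟩ : ∃ c, X * M.charpoly = X ^ p - C c * X := by
    by_cases hk1 : k (-1) = 0
    · refine ⟨_, X_mul_charpoly_eq_of_superdiagonal_eq_zero k (fun m hm => ?_) M hM⟩
      rcases hm.lt_or_eq with hm | rfl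
      exacts [hk m hm, hk1]
    have hYx : Y (xA F p) = u := by
      rw [hYu, Derivation.smul_apply, hD, smul_eq_mul, mul_one]
    have haug : augmentation F hp0 u ≠ 0 := by
      rwa [hu, map_sum, Finset.sum_eq_single 0 (fun n _ hn => by simp [hn]) (by simp [hp0]),
        pow_zero, map_smul, map_one, smul_eq_mul, mul_one, Nat.cast_zero, zero_sub]
    obtain ⟨c, hc⟩ := derivation_pow_char_eq_smul hD (isUnit_of_augmentation_ne_zero hp0 haug)
    rw [← hYu] at hc
    refine ⟨c, sub_eq_zero.1 (eq_zero_of_aeval_eq_zero hp0 (Y := Y) (by rwa [hYx]) ?_ ?_)⟩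
    · refine degree_sub_X_pow_sub_lt (monic_X.mul M.charpoly_monic) ?_ (by omega) c
      rw [degree_mul, degree_X, Matrix.charpoly_degree_eq_dim, Fintype.card_fin]
      exact_mod_cast (by omega : 1 + (p - 1) = p)
    · rw [map_sub, hann, map_sub, map_pow, map_mul, aeval_X, aeval_C, hc,
        ← Algebra.smul_def, sub_self, sub_zero]
  have hdet : M.det = -c := by
    have h1 := congrArg (fun q => q.coeff 1) hc
    have heven : Even (p - 1) :=
      Nat.Prime.even_sub_one Fact.out (by omega)
    simp only [coeff_X_mul, coeff_sub, coeff_X_pow, coeff_C_mul, coeff_X_one] at h1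
    rw [Matrix.det_eq_sign_charpoly_coeff, Fintype.card_fin, heven.neg_one_pow, one_mul]
    rw [show M.charpoly.coeff 0 = _ from h1, if_neg (by omega)]
    ring
  have hmain : Y.toLinearMap ^ p = -M.det • Y.toLinearMap := by
    rw [hc, map_sub, map_pow, map_mul, aeval_X, aeval_C, ← Algebra.smul_def, sub_eq_zero] at hann
    rw [hann, hdet, neg_neg]
  refine ⟨hmain, fun h => ?_, fun h => by rw [hmain, h, neg_zero, zero_smul]⟩
  rw [hmain] at h
  rcases smul_eq_zero.1 h with h | h
  · exact neg_eq_zero.1 h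
  · have hM0 : M = 0 := by
      ext i j
      have hj := j.2
      have hcol := congrFun (hπ (xA F p ^ ((j : ℕ) + 1))) i
      rw [show Y (xA F p ^ ((j : ℕ) + 1)) = 0 from LinearMap.congr_fun h _, map_zero] at hcol
      simpa [Matrix.mulVec, dotProduct, coeff_xA_pow _ (show (j : ℕ) + 1 < p by omega),
        Fin.val_inj] using hcol.symm
    have : Nonempty (Fin (p - 1)) := ⟨⟨0, by omega⟩⟩
    rw [hM0, Matrix.det_zero]
end
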